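/- arXiv:2201.04678 — 8 statements merged into one kernel-verified Lean document; each statement's English description precedes it below -/
import Mathlib

section
/- Let G and H be connected graphs, let M be a nonempty proper module of G, and let G' be the graph obtained from G by replacing G[M] with H. If the chromatic number of G[M] equals the chromatic number of H, then the chromatic number of G' is at most the chromatic number of G. -/
open SimpleGraph Set

/-- `M` is a module of `G`: every vertex outside `M` is adjacent to all of `M`
or to none of `M`. -/
def SimpleGraph.IsModuleSet {V : Type*} (G : SimpleGraph V) (M : Set V) : Prop :=
  ∀ v ∉ M, (∀ m ∈ M, G.Adj v m) ∨ (∀ m ∈ M, ¬ G.Adj v m)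

/-- The graph obtained from `G` by replacing `G[M]` with `H`: its vertices are
`(V ∖ M) ⊕ V(H)`, with the edges of `G` outside `M`, the edges of `H`, and all
edges between `N_G(M) ∖ M` and `V(H)`. -/
def modularReplacement {V W : Type*} (G : SimpleGraph V) (M : Set V)
    (H : SimpleGraph W) : SimpleGraph ({v : V // v ∉ M} ⊕ W) :=
  SimpleGraph.fromRel (fun x y =>
    match x, y with
    | Sum.inl u, Sum.inl v => G.Adj u.1 v.1
    | Sum.inl u, Sum.inr _ => ∃ m ∈ M, G.Adj u.1 m
    | Sum.inr _, Sum.inl _ => False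
    | Sum.inr u, Sum.inr v => H.Adj u v)

section Invariants

variable {V : Type*} (G : SimpleGraph V)

/-- A dominating set. -/
def IsDomSet (D : Set V) : Prop := ∀ v ∉ D, ∃ u ∈ D, G.Adj v u

/-- A minimum dominating set. -/
def IsMinDomSet (D : Set V) : Prop :=
  IsDomSet G D ∧ ∀ D', IsDomSet G D' → D.ncard ≤ D'.ncard

/-- The domination number. -/
noncomputable def domNum : ℕ := sInf {n | ∃ D, IsDomSet G D ∧ D.ncard = n}

/-- A vertex cover. -/
def IsVCover (C : Set V) : Prop := ∀ ⦃u v⦄, G.Adj u v → u ∈ C ∨ v ∈ C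

/-- A minimum vertex cover. -/
def IsMinVCover (C : Set V) : Prop :=
  IsVCover G C ∧ ∀ C', IsVCover G C' → C.ncard ≤ C'.ncard

/-- The vertex cover number. -/
noncomputable def vcNum : ℕ := sInf {n | ∃ C, IsVCover G C ∧ C.ncard = n}

/-- A connected vertex cover. -/
def IsCVCover (C : Set V) : Prop := IsVCover G C ∧ (G.induce C).Connected

/-- A minimum connected vertex cover. -/
def IsMinCVCover (C : Set V) : Prop :=
  IsCVCover G C ∧ ∀ C', IsCVCover G C' → C.ncard ≤ C'.ncard

/-- The connected vertex cover number. -/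
noncomputable def cvcNum : ℕ := sInf {n | ∃ C, IsCVCover G C ∧ C.ncard = n}

/-- A feedback vertex set: its removal leaves an acyclic graph. -/
def IsFVS (S : Set V) : Prop := (G.induce Sᶜ).IsAcyclic

/-- A minimum feedback vertex set. -/
def IsMinFVS (S : Set V) : Prop :=
  IsFVS G S ∧ ∀ S', IsFVS G S' → S.ncard ≤ S'.ncard

/-- The feedback vertex set number. -/
noncomputable def fvsNum : ℕ := sInf {n | ∃ S, IsFVS G S ∧ S.ncard = n}

/-- An odd cycle transversal: its removal leaves a bipartite graph. -/
def IsOCT (S : Set V) : Prop := (G.induce Sᶜ).Colorable 2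

/-- A minimum odd cycle transversal. -/
def IsMinOCT (S : Set V) : Prop :=
  IsOCT G S ∧ ∀ S', IsOCT G S' → S.ncard ≤ S'.ncard

/-- The odd cycle transversal number. -/
noncomputable def octNum : ℕ := sInf {n | ∃ S, IsOCT G S ∧ S.ncard = n}

/-- An independent set: pairwise non-adjacent vertices. -/
def IsIndepSet' (I : Set V) : Prop := I.Pairwise (fun u v => ¬ G.Adj u v)

/-- A partition of `G` into `k` (vertex-disjoint) paths covering all vertices. -/
def IsPathPartition (k : ℕ) (P : Fin k → (u : V) × (v : V) × G.Walk u v) : Prop :=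
  (∀ i, (P i).2.2.IsPath) ∧
  (∀ i j, i ≠ j → ∀ x, x ∈ (P i).2.2.support → x ∉ (P j).2.2.support) ∧
  (∀ x : V, ∃ i, x ∈ (P i).2.2.support)

/-- The minimum number of paths in a partition of `G` into paths. -/
noncomputable def pathPartitionNum : ℕ :=
  sInf {k | ∃ P : Fin k → (u : V) × (v : V) × G.Walk u v, IsPathPartition G k P}

/-- `G` has a Hamiltonian cycle. -/
def HasHamCycle : Prop := ∃ (v : V) (p : G.Walk v v), p.IsCycle ∧ ∀ u : V, u ∈ p.support

/-- The number of vertices of a longest induced path of `G`. -/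
noncomputable def lipNum : ℕ :=
  sSup {n | ∃ S : Set V, Nonempty (G.induce S ≃g pathGraph n)}

/-- `X` is an induced matching with `k` edges: `X` has `2k` vertices and the
subgraph induced by `X` is `1`-regular. -/
def IsInducedMatching (X : Set V) (k : ℕ) : Prop :=
  X.ncard = 2 * k ∧ ∀ v ∈ X, ∃! u, u ∈ X ∧ G.Adj v u

/-- The maximum number of edges of an induced matching of `G`. -/
noncomputable def imNum : ℕ := sSup {k | ∃ X, IsInducedMatching G X k}

/-- An independent triangle packing with `k` triangles: pairwise disjoint
triangles with no edges of `G` between different triangles. -/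
def IsIndepTrianglePacking (k : ℕ) (f : Fin k → Set V) : Prop :=
  (∀ i, ∃ a b c : V, f i = {a, b, c} ∧ G.Adj a b ∧ G.Adj a c ∧ G.Adj b c) ∧
  (∀ i j, i ≠ j → ∀ u ∈ f i, ∀ v ∈ f j, u ≠ v ∧ ¬ G.Adj u v)

/-- The maximum number of triangles in an independent triangle packing of `G`. -/
noncomputable def itpNum : ℕ :=
  sSup {k | ∃ f : Fin k → Set V, IsIndepTrianglePacking G k f}

/-- `C` is the vertex set of an induced cycle of `G`. -/
def IsCycleSet (C : Set V) : Prop :=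
  3 ≤ C.ncard ∧ (G.induce C).Connected ∧ ∀ v ∈ C, {u | u ∈ C ∧ G.Adj v u}.ncard = 2

/-- An independent cycle packing with `k` cycles: pairwise disjoint induced
cycles with no edges of `G` between different cycles. -/
def IsIndepCyclePacking (k : ℕ) (f : Fin k → Set V) : Prop :=
  (∀ i, IsCycleSet G (f i)) ∧
  (∀ i j, i ≠ j → ∀ u ∈ f i, ∀ v ∈ f j, u ≠ v ∧ ¬ G.Adj u v)

/-- The maximum number of cycles in an independent cycle packing of `G`. -/
noncomputable def icpNum : ℕ :=
  sSup {k | ∃ f : Fin k → Set V, IsIndepCyclePacking G k f}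

end Invariants

/-- If the subgraph induced by a module `M` is at least as hard to color as `H`, then every coloring
of `G` by finitely many colors yields a coloring of the modular replacement by the same colors:
`H` is colored with the colors used on `M`. -/
theorem nonempty_coloring_modularReplacement {V W α : Type*} [Finite α]
    {G : SimpleGraph V} {H : SimpleGraph W} {M : Set V} (hMod : G.IsModuleSet M)
    (hchrom : H.chromaticNumber ≤ (G.induce M).chromaticNumber) (C : G.Coloring α) :
    Nonempty ((modularReplacement G M H).Coloring α) := by
  have : Fintype (C '' M) := Fintype.ofFinite _
  let CM : (G.induce M).Coloring (C '' M) :=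
    Coloring.mk (fun m => ⟨C m, m, m.2, rfl⟩) fun {u v} h => by
      simpa [Subtype.ext_iff] using C.valid h
  have hH : H.Colorable (Fintype.card (C '' M)) :=
    chromaticNumber_le_iff_colorable.1 (hchrom.trans CM.colorable.chromaticNumber_le)
  let D : H.Coloring (C '' M) := hH.toColoring le_rfl
  have hcross : ∀ (u : {v : V // v ∉ M}) (w : W), (∃ m ∈ M, G.Adj u.1 m) → C u.1 ≠ D w := by
    rintro u w ⟨m, hm, hum⟩ heq
    obtain ⟨m', hm', hw⟩ := (D w).2
    rcases hMod u.1 u.2 with h | h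
    · exact C.valid (h m' hm') (heq.trans hw.symm)
    · exact h m hm hum
  refine ⟨Coloring.mk (Sum.elim (fun v => C v.1) (fun w => (D w).1)) ?_⟩
  rintro (u | u) (v | v) ⟨-, h⟩
  · exact C.valid (h.elim id SimpleGraph.Adj.symm)
  · exact hcross u v (h.elim id False.elim)
  · exact (hcross v u (h.elim False.elim id)).symm
  · exact fun heq => D.valid (h.elim id SimpleGraph.Adj.symm) (Subtype.ext heq)

theorem stmt0 {V W : Type*} [Fintype V] [Fintype W]
    (G : SimpleGraph V) (H : SimpleGraph W) (M : Set V)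
    (hG : G.Connected) (hH : H.Connected)
    (hMod : G.IsModuleSet M) (hne : M.Nonempty) (hproper : M ≠ Set.univ)
    (hchrom : (G.induce M).chromaticNumber = H.chromaticNumber) :
    (modularReplacement G M H).chromaticNumber ≤ G.chromaticNumber := by
  obtain ⟨C⟩ := G.colorable_chromaticNumber_of_fintype
  rw [← ENat.natCast_toNat (chromaticNumber_ne_top_iff_exists.2 ⟨_, ⟨C⟩⟩)]
  exact chromaticNumber_le_iff_colorable.2 (nonempty_coloring_modularReplacement hMod hchrom.ge C)
end

section
/- Let G be a connected graph, let M be a nonempty proper module of G, and let D be a minimum dominating set of G. Then M ∩ D is either empty, a single vertex, or a minimum dominating set of the induced subgraph G[M]. -/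
open SimpleGraph Set

/-- Replacing the part of a dominating set inside a module `M` by a nonempty subset `S` of `M`
gives a dominating set as soon as the vertices of `M` stay dominated. -/
theorem IsDomSet.replace_in_module {V : Type*} {G : SimpleGraph V} {M D S : Set V}
    (hD : IsDomSet G D) (hMod : G.IsModuleSet M) (hSM : S ⊆ M) (hS : S.Nonempty)
    (hdom : ∀ m ∈ M, m ∉ S → ∃ u ∈ D \ M ∪ S, G.Adj m u) :
    IsDomSet G (D \ M ∪ S) := by
  intro v hv
  by_cases hvM : v ∈ M
  · exact hdom v hvM fun h => hv (Or.inr h)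
  · obtain ⟨u, hu, huv⟩ := hD v fun h => hv (Or.inl ⟨h, hvM⟩)
    by_cases huM : u ∈ M
    · obtain ⟨s, hs⟩ := hS
      rcases hMod v hvM with h | h
      · exact ⟨s, Or.inr hs, h s (hSM hs)⟩
      · exact absurd huv (h u huM)
    · exact ⟨u, Or.inl ⟨hu, huM⟩, huv⟩

/-- A minimum dominating set meets a module `M` in at most as many vertices as any nonempty
subset of `M` that can replace this intersection. -/
theorem IsMinDomSet.ncard_inter_module_le {V : Type*} [Finite V] {G : SimpleGraph V}
    {M D S : Set V} (hD : IsMinDomSet G D) (hMod : G.IsModuleSet M) (hSM : S ⊆ M)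
    (hS : S.Nonempty) (hdom : ∀ m ∈ M, m ∉ S → ∃ u ∈ D \ M ∪ S, G.Adj m u) :
    (M ∩ D).ncard ≤ S.ncard := by
  have h₁ := hD.2 _ (hD.1.replace_in_module hMod hSM hS hdom)
  have h₂ := Set.ncard_union_le (D \ M) S
  have h₃ := Set.ncard_inter_add_ncard_sdiff_eq_ncard D M
  rw [Set.inter_comm] at h₃
  omega

theorem stmt1 {V : Type*} [Fintype V]
    (G : SimpleGraph V) (M : Set V)
    (hG : G.Connected) (hMod : G.IsModuleSet M) (hne : M.Nonempty)
    (hproper : M ≠ Set.univ)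
    (D : Set V) (hD : IsMinDomSet G D) :
    M ∩ D = ∅ ∨ (∃ v, M ∩ D = {v}) ∨
      IsMinDomSet (G.induce M) {x : M | ↑x ∈ D} := by
  rcases Set.eq_empty_or_nonempty (M ∩ D) with h_empty | ⟨m, hmM, hmD⟩
  · exact Or.inl h_empty
  right
  by_cases hw : ∃ w ∈ D \ M, ∀ x ∈ M, G.Adj w x
  · obtain ⟨w, hwD, hwM⟩ := hw
    have hle := hD.ncard_inter_module_le hMod (Set.singleton_subset_iff.2 hmM)
      (Set.singleton_nonempty m) fun x hx _ => ⟨w, Or.inl hwD, (hwM x hx).symm⟩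
    refine Or.inl ⟨m, (Set.eq_of_subset_of_ncard_le ?_ hle).symm⟩
    exact Set.singleton_subset_iff.2 ⟨hmM, hmD⟩
  · refine Or.inr ⟨?_, ?_⟩
    · rintro ⟨x, hx⟩ hxD
      obtain ⟨u, hu, hxu⟩ := hD.1 x hxD
      have huM : u ∈ M := by
        by_contra huM
        rcases hMod u huM with h | h
        · exact hw ⟨u, ⟨hu, huM⟩, h⟩
        · exact h x hx hxu.symm
      exact ⟨⟨u, huM⟩, hu, hxu⟩
    · intro S hS
      have hSne : S.Nonempty := by
        by_cases h : (⟨m, hmM⟩ : M) ∈ S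
        · exact ⟨_, h⟩
        · obtain ⟨u, hu, -⟩ := hS _ h
          exact ⟨u, hu⟩
      have hle := hD.ncard_inter_module_le (S := Subtype.val '' S) hMod
        (Subtype.coe_image_subset M S) (hSne.image _) fun x hx hxS => by
          obtain ⟨u, hu, hxu⟩ := hS ⟨x, hx⟩ fun h => hxS ⟨_, h, rfl⟩
          exact ⟨u, Or.inr ⟨u, hu, rfl⟩, hxu⟩
      rw [Set.ncard_image_of_injective _ Subtype.val_injective] at hle
      rw [← Set.ncard_image_of_injective _ Subtype.val_injective]
      convert hle using 2
      exact Subtype.image_preimage_coe M D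
end

section
/- Let G and H be graphs, let M be a module of G, and let G' be the graph obtained from G by replacing G[M] with H. Suppose I_{G[M]} is an independent set of G[M], I_H is an independent set of H, |I_{G[M]}| = |I_H|, and S ⊆ V(G)∖M. Then the subgraph induced in G by S ∪ I_{G[M]} is isomorphic to the subgraph induced in G' by S ∪ I_H. -/
open SimpleGraph Set

section Replacement

variable {V W : Type*} {G : SimpleGraph V} {M : Set V} {H : SimpleGraph W}

theorem modularReplacement_adj_inl_inl {u v : {v : V // v ∉ M}} :
    (modularReplacement G M H).Adj (Sum.inl u) (Sum.inl v) ↔ G.Adj u.1 v.1 := by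
  simp only [modularReplacement, fromRel_adj, ne_eq, Sum.inl.injEq, G.adj_comm v.1, or_self,
    and_iff_right_iff_imp]
  rintro h rfl
  exact h.ne rfl

theorem modularReplacement_adj_inr_inr {u v : W} :
    (modularReplacement G M H).Adj (Sum.inr u) (Sum.inr v) ↔ H.Adj u v := by
  simp only [modularReplacement, fromRel_adj, ne_eq, Sum.inr.injEq, H.adj_comm v, or_self,
    and_iff_right_iff_imp]
  exact fun h => h.ne

theorem SimpleGraph.IsModuleSet.modularReplacement_adj_inl_inr (hMod : G.IsModuleSet M)
    {u : {v : V // v ∉ M}} {w : W} {m : V} (hm : m ∈ M) :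
    (modularReplacement G M H).Adj (Sum.inl u) (Sum.inr w) ↔ G.Adj u.1 m := by
  simp only [modularReplacement, fromRel_adj, ne_eq, reduceCtorEq, not_false_eq_true, or_false,
    true_and]
  refine ⟨fun ⟨n, hn, h⟩ => ?_, fun h => ⟨m, hm, h⟩⟩
  exact (hMod u.1 u.2).elim (fun hall => hall m hm) (fun hnone => absurd h (hnone n hn))

theorem IsIndepSet'.not_adj {I : Set V} (hI : IsIndepSet' G I) {u v : V} (hu : u ∈ I)
    (hv : v ∈ I) : ¬ G.Adj u v :=
  fun h => hI hu hv h.ne h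

end Replacement

theorem stmt2 {V W : Type*} [Fintype V] [Fintype W]
    (G : SimpleGraph V) (H : SimpleGraph W) (M : Set V)
    (hMod : G.IsModuleSet M)
    (S I : Set V) (IH : Set W)
    (hSM : ∀ v ∈ S, v ∉ M) (hIM : I ⊆ M)
    (hI : IsIndepSet' G I) (hIH : IsIndepSet' H IH)
    (hcard : I.ncard = IH.ncard) :
    Nonempty ((G.induce (S ∪ I)) ≃g
      ((modularReplacement G M H).induce
        ((Sum.inl '' {u : {v : V // v ∉ M} | ↑u ∈ S} ∪ Sum.inr '' IH :
          Set ({v : V // v ∉ M} ⊕ W))))) := by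
  classical
  obtain ⟨e⟩ : Nonempty (I ≃ IH) := by
    rw [← Finite.card_eq]
    exact hcard
  have hI_of {x : V} (hx : x ∈ S ∪ I) (hxM : x ∈ M) : x ∈ I :=
    hx.resolve_left fun h => hSM x h hxM
  have hS_of {x : V} (hx : x ∈ S ∪ I) (hxM : x ∉ M) : x ∈ S :=
    hx.resolve_right fun h => hxM (hIM h)
  let f : ↥(S ∪ I) → {v : V // v ∉ M} ⊕ W := fun x =>
    if hx : x.1 ∈ M then Sum.inr (e ⟨x.1, hI_of x.2 hx⟩).1 else Sum.inl ⟨x.1, hx⟩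
  have f_pos (x : ↥(S ∪ I)) (hx : x.1 ∈ M) : f x = Sum.inr (e ⟨x.1, hI_of x.2 hx⟩).1 :=
    dif_pos hx
  have f_neg (x : ↥(S ∪ I)) (hx : x.1 ∉ M) : f x = Sum.inl ⟨x.1, hx⟩ := dif_neg hx
  have f_mem (x : ↥(S ∪ I)) :
      f x ∈ (Sum.inl '' {u : {v : V // v ∉ M} | ↑u ∈ S} ∪ Sum.inr '' IH :
        Set ({v : V // v ∉ M} ⊕ W)) := by
    by_cases hx : x.1 ∈ M
    · rw [f_pos x hx]
      exact Or.inr ⟨_, (e _).2, rfl⟩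
    · rw [f_neg x hx]
      exact Or.inl ⟨_, hS_of x.2 hx, rfl⟩
  have f_inj : Function.Injective f := by
    intro x y h
    by_cases hx : x.1 ∈ M <;> by_cases hy : y.1 ∈ M
    · rw [f_pos x hx, f_pos y hy] at h
      have h' := e.injective (Subtype.ext (Sum.inr.inj h))
      exact Subtype.ext (congrArg (fun z : I => z.1) h')
    · simp [f_pos x hx, f_neg y hy] at h
    · simp [f_neg x hx, f_pos y hy] at h
    · rw [f_neg x hx, f_neg y hy] at h
      exact Subtype.ext (Subtype.mk.inj (Sum.inl.inj h))
  have f_adj (x y : ↥(S ∪ I)) :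
      (modularReplacement G M H).Adj (f x) (f y) ↔ G.Adj x.1 y.1 := by
    by_cases hx : x.1 ∈ M <;> by_cases hy : y.1 ∈ M
    · rw [f_pos x hx, f_pos y hy, modularReplacement_adj_inr_inr]
      exact iff_of_false (hIH.not_adj (e _).2 (e _).2)
        (hI.not_adj (hI_of x.2 hx) (hI_of y.2 hy))
    · rw [f_pos x hx, f_neg y hy, adj_comm, hMod.modularReplacement_adj_inl_inr hx, adj_comm]
    · rw [f_neg x hx, f_pos y hy, hMod.modularReplacement_adj_inl_inr hy]
    · rw [f_neg x hx, f_neg y hy, modularReplacement_adj_inl_inl]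
  refine ⟨⟨Equiv.ofBijective (fun x => ⟨f x, f_mem x⟩) ⟨?_, ?_⟩, f_adj _ _⟩⟩
  · exact fun x y h => f_inj (congrArg Subtype.val h)
  · rintro ⟨_, ⟨u, hu, rfl⟩ | ⟨w, hw, rfl⟩⟩
    · exact ⟨⟨u.1, Or.inl hu⟩, Subtype.ext (f_neg ⟨u.1, Or.inl hu⟩ u.2)⟩
    · have hz := (e.symm ⟨w, hw⟩).2
      refine ⟨⟨_, Or.inr hz⟩, Subtype.ext ((f_pos ⟨_, Or.inr hz⟩ (hIM hz)).trans ?_)⟩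
      simp
end

section
/- Let G be a connected graph, let M be a nonempty proper module of G, and let C be a minimum vertex cover of G. Then M ∩ C is either equal to M or a minimum vertex cover of the induced subgraph G[M]. -/
open SimpleGraph Set

/-- If a vertex cover misses a vertex of the module `M`, its part inside `M` can be exchanged
for any vertex cover of `G[M]`. -/
theorem IsVCover.exchange_module {V : Type*} {G : SimpleGraph V} {M C : Set V}
    (hMod : G.IsModuleSet M) (hC : IsVCover G C) {m : V} (hm : m ∈ M) (hmC : m ∉ C)
    {D : Set M} (hD : IsVCover (G.induce M) D) :
    IsVCover G (C \ M ∪ Subtype.val '' D) := by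
  have cross : ∀ ⦃u v⦄, G.Adj u v → u ∉ M → v ∈ M → u ∈ C := by
    intro u v huv hu hv
    have hum : G.Adj u m :=
      (hMod u hu).resolve_right (fun h => h v hv huv) m hm
    exact (hC hum).resolve_right hmC
  intro u v huv
  by_cases hu : u ∈ M <;> by_cases hv : v ∈ M
  · have huv' : (G.induce M).Adj ⟨u, hu⟩ ⟨v, hv⟩ := huv
    exact (hD huv').imp (fun h => Or.inr ⟨_, h, rfl⟩) (fun h => Or.inr ⟨_, h, rfl⟩)
  · exact Or.inr (Or.inl ⟨cross huv.symm hv hu, hv⟩)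
  · exact Or.inl (Or.inl ⟨cross huv hu hv, hu⟩)
  · exact (hC huv).imp (fun h => Or.inl ⟨h, hu⟩) (fun h => Or.inl ⟨h, hv⟩)

theorem stmt5 {V : Type*} [Fintype V]
    (G : SimpleGraph V) (M : Set V)
    (hG : G.Connected) (hMod : G.IsModuleSet M) (hne : M.Nonempty)
    (hproper : M ≠ Set.univ)
    (C : Set V) (hC : IsMinVCover G C) :
    M ∩ C = M ∨ IsMinVCover (G.induce M) {x : M | ↑x ∈ C} := by
  refine or_iff_not_imp_left.2 fun h => ⟨fun u v huv => hC.1 huv, fun D hD => ?_⟩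
  obtain ⟨m, hm, hmC⟩ := Set.not_subset.1 (fun hsub => h (Set.inter_eq_left.2 hsub))
  have hle := hC.2 _ (hC.1.exchange_module hMod hm hmC hD)
  have hunion := Set.ncard_union_le (C \ M) (Subtype.val '' D)
  rw [Set.ncard_image_of_injective D Subtype.val_injective] at hunion
  have hsplit := Set.ncard_inter_add_ncard_sdiff_eq_ncard C M (Set.toFinite C)
  have himage : Subtype.val '' {x : M | ↑x ∈ C} = C ∩ M := by
    ext x
    simp [and_comm]
  rw [← himage, Set.ncard_image_of_injective _ Subtype.val_injective] at hsplit
  omega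
end

section
/- Let G be a connected graph, let M be a nonempty proper module of G, and let F be a minimum feedback vertex set of G. Then M ∩ F is either equal to M, equal to M∖{v} for some vertex v ∈ M, a minimum vertex cover of the induced subgraph G[M], or a minimum feedback vertex set of G[M]. -/
open SimpleGraph Set

lemma isFVS_iff_forall_isCycle {V : Type*} {G : SimpleGraph V} {S : Set V} :
    IsFVS G S ↔ ∀ ⦃v : V⦄ (p : G.Walk v v), p.IsCycle → ∃ x ∈ p.support, x ∈ S := by
  constructor
  · intro h v p hp
    by_contra! hS
    refine h (p.induce Sᶜ hS) ?_
    apply Walk.IsCycle.of_map (f := (Embedding.induce Sᶜ).toHom)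
    rw [Walk.map_induce]
    exact hp
  · intro h v p hp
    obtain ⟨x, hx, hxS⟩ := h (p.map (Embedding.induce Sᶜ).toHom)
      (hp.map Subtype.val_injective)
    rw [Walk.support_map, List.mem_map] at hx
    obtain ⟨y, -, rfl⟩ := hx
    exact y.2 hxS

/-- A walk in `G` that avoids every neighbor of `M` outside `M` stays on one side of `M`. -/
lemma mem_iff_mem_of_mem_support {V : Type*} {G : SimpleGraph V} {M S : Set V}
    (hS : ∀ a ∉ M, ∀ m ∈ M, G.Adj a m → a ∈ S) {u v : V} (p : G.Walk u v)
    (hp : ∀ x ∈ p.support, x ∉ S) {x : V} (hx : x ∈ p.support) : x ∈ M ↔ u ∈ M := by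
  induction p with
  | nil => simp_all
  | @cons u w v h p ih =>
    have huw : w ∈ M ↔ u ∈ M := by
      have hu : u ∉ S := hp _ (by simp)
      have hw : w ∉ S := hp _ (by simp)
      by_contra hne
      by_cases hwM : w ∈ M
      · exact hu (hS u (by tauto) w hwM h)
      · exact hw (hS w hwM u (by tauto) h.symm)
    rw [Walk.support_cons, List.mem_cons] at hx
    rcases hx with rfl | hx
    · rfl
    · rw [ih (fun y hy => hp y (by simp [hy])) hx, huw]

lemma exists_ne_adj_of_isCycle {V : Type*} {G : SimpleGraph V} {v x : V} {p : G.Walk v v}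
    (hp : p.IsCycle) (hx : x ∈ p.support) :
    ∃ a ∈ p.support, ∃ b ∈ p.support, a ≠ b ∧ G.Adj x a ∧ G.Adj x b := by
  obtain ⟨a, b, hab, h⟩ := Set.ncard_eq_two.1 (hp.ncard_neighborSet_toSubgraph_eq_two hx)
  have ha : p.toSubgraph.Adj x a := by
    rw [← Subgraph.mem_neighborSet, h]; simp
  have hb : p.toSubgraph.Adj x b := by
    rw [← Subgraph.mem_neighborSet, h]; simp
  exact ⟨a, Walk.mem_support_of_adj_toSubgraph ha.symm,
    b, Walk.mem_support_of_adj_toSubgraph hb.symm, hab, ha.adj_sub, hb.adj_sub⟩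

lemma IsFVS.exists_mem_triangle {V : Type*} {G : SimpleGraph V} {S : Set V} (hS : IsFVS G S)
    {a b c : V} (hab : G.Adj a b) (hbc : G.Adj b c) (hca : G.Adj c a) :
    a ∈ S ∨ b ∈ S ∨ c ∈ S := by
  obtain ⟨x, hx, hxS⟩ := isFVS_iff_forall_isCycle.1 hS
    (Walk.cons hab (Walk.cons hbc (Walk.cons hca Walk.nil))) (by
      have h₁ := hab.ne
      have h₂ := hbc.ne
      have h₃ := hca.ne
      rw [Walk.cons_isCycle_iff]
      simp [Walk.isPath_def]
      grind)
  simp at hx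
  grind

lemma IsFVS.exists_mem_square {V : Type*} {G : SimpleGraph V} {S : Set V} (hS : IsFVS G S)
    {a b c d : V} (hab : G.Adj a b) (hbc : G.Adj b c) (hcd : G.Adj c d) (hda : G.Adj d a)
    (hac : a ≠ c) (hbd : b ≠ d) : a ∈ S ∨ b ∈ S ∨ c ∈ S ∨ d ∈ S := by
  obtain ⟨x, hx, hxS⟩ := isFVS_iff_forall_isCycle.1 hS
    (Walk.cons hab (Walk.cons hbc (Walk.cons hcd (Walk.cons hda Walk.nil)))) (by
      have h₁ := hab.ne
      have h₂ := hbc.ne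
      have h₃ := hcd.ne
      have h₄ := hda.ne
      rw [Walk.cons_isCycle_iff]
      simp [Walk.isPath_def]
      grind)
  simp at hx
  grind

/-- If exchanging the part of a minimum feedback vertex set `F` inside `M` for `S` gives a
feedback vertex set, then `S` is at least as large as the part exchanged. -/
lemma IsMinFVS.ncard_le_of_isFVS_exchange {V : Type*} [Finite V] {G : SimpleGraph V}
    {F M : Set V} (hF : IsMinFVS G F) (S : Set M)
    (hS : IsFVS G ((F \ M) ∪ Subtype.val '' S)) : {x : M | ↑x ∈ F}.ncard ≤ S.ncard := by
  have h₁ := hF.2 _ hS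
  have h₂ := Set.ncard_union_le (F \ M) (Subtype.val '' S)
  have h₃ := Set.ncard_inter_add_ncard_sdiff_eq_ncard F M
  rw [Set.ncard_image_of_injective _ Subtype.val_injective] at h₂
  have h₄ : F ∩ M = Subtype.val '' {x : M | ↑x ∈ F} := by
    ext x; simp [and_comm]
  rw [h₄, Set.ncard_image_of_injective _ Subtype.val_injective] at h₃
  omega

/-- If `F` contains all neighbors of `M` outside `M`, then the part of `F` inside `M` may be
exchanged for any feedback vertex set of `G[M]`. -/
lemma IsFVS.exchange_isFVS {V : Type*} {G : SimpleGraph V} {F M : Set V} (hF : IsFVS G F)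
    (hN : ∀ a ∉ M, ∀ m ∈ M, G.Adj a m → a ∈ F) {S : Set M} (hS : IsFVS (G.induce M) S) :
    IsFVS G ((F \ M) ∪ Subtype.val '' S) := by
  rw [isFVS_iff_forall_isCycle] at *
  intro v p hp
  by_contra! hav
  have hside : ∀ x ∈ p.support, (x ∈ M ↔ v ∈ M) := fun x =>
    mem_iff_mem_of_mem_support (fun a ha m hm h => Or.inl ⟨hN a ha m hm h, ha⟩) p hav
  by_cases hv : v ∈ M
  · obtain ⟨x, hx, hxS⟩ := hS (p.induce M fun x hx => (hside x hx).2 hv) (by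
      apply Walk.IsCycle.of_map (f := (Embedding.induce M).toHom)
      rw [Walk.map_induce]
      exact hp)
    exact hav x (by simpa using hx) (Or.inr ⟨x, hxS, rfl⟩)
  · obtain ⟨x, hx, hxF⟩ := hF p hp
    exact hav x hx (Or.inl ⟨hxF, fun hxM => hv ((hside x hx).1 hxM)⟩)

/-- If at most one neighbor of `M` outside `M` is missing from `F`, then the part of `F` inside
`M` may be exchanged for any vertex cover of `G[M]`. -/
lemma IsFVS.exchange_isVCover {V : Type*} {G : SimpleGraph V} {F M : Set V} (hF : IsFVS G F)
    (hN : {a | a ∉ M ∧ a ∉ F ∧ ∃ m ∈ M, G.Adj a m}.Subsingleton) {C : Set M}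
    (hC : IsVCover (G.induce M) C) : IsFVS G ((F \ M) ∪ Subtype.val '' C) := by
  rw [isFVS_iff_forall_isCycle] at *
  intro v p hp
  by_contra! hav
  by_cases hM : ∃ x ∈ p.support, x ∈ M
  · obtain ⟨x, hx, hxM⟩ := hM
    have hout : ∀ a ∈ p.support, G.Adj x a → a ∉ M ∧ a ∉ F ∧ ∃ m ∈ M, G.Adj a m := by
      intro a ha hxa
      have haM : a ∉ M := fun haM => by
        rcases hC (u := ⟨x, hxM⟩) (v := ⟨a, haM⟩) hxa with h | h
        · exact hav x hx (Or.inr ⟨_, h, rfl⟩)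
        · exact hav a ha (Or.inr ⟨_, h, rfl⟩)
      exact ⟨haM, fun haF => hav a ha (Or.inl ⟨haF, haM⟩), x, hxM, hxa.symm⟩
    obtain ⟨a, ha, b, hb, hab, hxa, hxb⟩ := exists_ne_adj_of_isCycle hp hx
    exact hab (hN (hout a ha hxa) (hout b hb hxb))
  · push Not at hM
    obtain ⟨x, hx, hxF⟩ := hF p hp
    exact hav x hx (Or.inl ⟨hxF, hM x hx⟩)

lemma IsFVS.induce {V : Type*} {G : SimpleGraph V} {F : Set V} (hF : IsFVS G F) (M : Set V) :
    IsFVS (G.induce M) {x : M | ↑x ∈ F} := by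
  rw [isFVS_iff_forall_isCycle] at *
  intro v p hp
  obtain ⟨x, hx, hxF⟩ := hF (p.map (Embedding.induce M).toHom)
    (hp.map Subtype.val_injective)
  rw [Walk.support_map, List.mem_map] at hx
  obtain ⟨y, hy, rfl⟩ := hx
  exact ⟨y, hy, hxF⟩

theorem stmt6 {V : Type*} [Fintype V]
    (G : SimpleGraph V) (M : Set V)
    (hG : G.Connected) (hMod : G.IsModuleSet M) (hne : M.Nonempty)
    (hproper : M ≠ Set.univ)
    (F : Set V) (hF : IsMinFVS G F) :
    M ∩ F = M ∨ (∃ v ∈ M, M ∩ F = M \ {v}) ∨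
      IsMinVCover (G.induce M) {x : M | ↑x ∈ F} ∨
      IsMinFVS (G.induce M) {x : M | ↑x ∈ F} := by
  by_cases hsub : (M \ F).Subsingleton
  · rcases hsub.eq_empty_or_singleton with h | ⟨v, h⟩
    · exact Or.inl (Set.inter_eq_left.2 (Set.sdiff_eq_empty.1 h))
    · refine Or.inr (Or.inl ⟨v, ?_, ?_⟩)
      · exact (h.symm ▸ Set.mem_singleton v : v ∈ M \ F).1
      · rw [← h]; simp
  obtain ⟨x, ⟨hxM, hxF⟩, y, ⟨hyM, hyF⟩, hxy⟩ := Set.not_subsingleton_iff.1 hsub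
  have hall : ∀ a ∉ M, (∃ m ∈ M, G.Adj a m) → ∀ m ∈ M, G.Adj a m := by
    rintro a ha ⟨m, hm, ham⟩
    exact (hMod a ha).resolve_right fun h => h m hm ham
  refine Or.inr (Or.inr ?_)
  by_cases hN : ∀ a ∉ M, ∀ m ∈ M, G.Adj a m → a ∈ F
  · exact Or.inr ⟨hF.1.induce M, fun S hS =>
      hF.ncard_le_of_isFVS_exchange S (hF.1.exchange_isFVS hN hS)⟩
  · push Not at hN
    obtain ⟨a, haM, m, hm, ham, haF⟩ := hN
    have ha := hall a haM ⟨m, hm, ham⟩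
    refine Or.inl ⟨fun u v huv => ?_, fun C hC =>
      hF.ncard_le_of_isFVS_exchange C (hF.1.exchange_isVCover ?_ hC)⟩
    · exact (hF.1.exists_mem_triangle (ha u u.2) huv (ha v v.2).symm).resolve_left haF
    · rintro b ⟨hbM, hbF, hb⟩ c ⟨hcM, hcF, hc⟩
      by_contra hbc
      have := hF.1.exists_mem_square (hall b hbM hb x hxM) (hall c hcM hc x hxM).symm
        (hall c hcM hc y hyM) (hall b hbM hb y hyM).symm hbc hxy
      tauto
end

section
/- Let G be a connected graph, let M be a nonempty proper module of G, and let O be a minimum odd cycle transversal of G. Then M ∩ O is either equal to M, a minimum vertex cover of the induced subgraph G[M], or a minimum odd cycle transversal of G[M]. -/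
open SimpleGraph Set

theorem isOCT_iff_exists_coloring {V : Type*} {G : SimpleGraph V} {S : Set V} :
    IsOCT G S ↔ ∃ c : V → Bool, ∀ u v, u ∉ S → v ∉ S → G.Adj u v → c u ≠ c v := by
  classical
  constructor
  · intro h
    have C : (G.induce Sᶜ).Coloring Bool := h.toColoring (by simp)
    refine ⟨fun v => if hv : v ∈ Sᶜ then C ⟨v, hv⟩ else false, fun u v hu hv huv => ?_⟩
    have hu' : u ∈ Sᶜ := hu
    have hv' : v ∈ Sᶜ := hv
    simp only [dif_pos hu', dif_pos hv']
    exact C.valid (v := ⟨u, hu'⟩) (w := ⟨v, hv'⟩) huv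
  · rintro ⟨c, hc⟩
    let C : (G.induce Sᶜ).Coloring Bool :=
      SimpleGraph.Coloring.mk (fun v => c v.1) fun {u v} huv => hc u.1 v.1 u.2 v.2 huv
    unfold IsOCT
    simpa using C.colorable

/-- Exchanging the part of a minimum odd cycle transversal inside `M` for another subset of `M`
cannot decrease its size. -/
theorem IsMinOCT.ncard_le_of_exchange {V : Type*} [Finite V] {G : SimpleGraph V} {M O : Set V}
    (hO : IsMinOCT G O) (C : Set M) (hC : IsOCT G (O \ M ∪ Subtype.val '' C)) :
    {x : M | ↑x ∈ O}.ncard ≤ C.ncard := by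
  have h₁ := hO.2 _ hC
  have h₂ := Set.ncard_union_le (O \ M) (Subtype.val '' C)
  have h₃ : (Subtype.val '' C).ncard = C.ncard :=
    Set.ncard_image_of_injective _ Subtype.val_injective
  have h₄ : (Subtype.val '' {x : M | ↑x ∈ O}).ncard = {x : M | ↑x ∈ O}.ncard :=
    Set.ncard_image_of_injective _ Subtype.val_injective
  have h₅ : Subtype.val '' {x : M | ↑x ∈ O} = O ∩ M := by
    ext x
    simp
  have h₆ := Set.ncard_inter_add_ncard_sdiff_eq_ncard O M
  rw [h₅] at h₄
  omega

/-- If every vertex of `M` has all its outside neighbours in `O`, then a minimum odd cycle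
transversal `O` restricts to a minimum one on `M`. -/
theorem IsMinOCT.restrict_of_separated {V : Type*} [Finite V] {G : SimpleGraph V} {M O : Set V}
    (hO : IsMinOCT G O) (hsep : ∀ v ∉ M, v ∉ O → ∀ m ∈ M, ¬ G.Adj v m) :
    IsMinOCT (G.induce M) {x : M | ↑x ∈ O} := by
  classical
  obtain ⟨c, hc⟩ := isOCT_iff_exists_coloring.1 hO.1
  refine ⟨isOCT_iff_exists_coloring.2 ⟨fun x => c x, fun u v hu hv huv => hc u v hu hv huv⟩,
    fun C hC => hO.ncard_le_of_exchange C ?_⟩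
  obtain ⟨d, hd⟩ := isOCT_iff_exists_coloring.1 hC
  refine isOCT_iff_exists_coloring.2
    ⟨fun v => if hv : v ∈ M then d ⟨v, hv⟩ else c v, fun u v hu hv huv => ?_⟩
  by_cases huM : u ∈ M <;> by_cases hvM : v ∈ M <;> simp [huM, hvM] at hu hv ⊢
  · exact hd ⟨u, huM⟩ ⟨v, hvM⟩ hu hv huv
  · exact absurd huv.symm (hsep v hvM hv u huM)
  · exact absurd huv (hsep u huM hu v hvM)
  · exact hc u v hu hv huv

/-- If a minimum odd cycle transversal `O` avoids some vertex of the module `M` and some outside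
neighbour of `M`, then it restricts to a minimum vertex cover on `M`. -/
theorem IsMinOCT.isMinVCover_restrict {V : Type*} [Finite V] {G : SimpleGraph V} {M O : Set V}
    (hO : IsMinOCT G O) (hMod : G.IsModuleSet M) {v w : V} (hvM : v ∉ M) (hvO : v ∉ O)
    (hwM : w ∈ M) (hwO : w ∉ O) (hvw : G.Adj v w) :
    IsMinVCover (G.induce M) {x : M | ↑x ∈ O} := by
  classical
  obtain ⟨c, hc⟩ := isOCT_iff_exists_coloring.1 hO.1
  have hadj : ∀ x ∉ M, ∀ y ∈ M, ∀ z ∈ M, G.Adj x y → G.Adj x z := fun x hx y hy z hz hxy =>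
    (hMod x hx).elim (fun h => h z hz) fun h => absurd hxy (h y hy)
  refine ⟨fun a b hab => ?_, fun C hC => hO.ncard_le_of_exchange C ?_⟩
  · by_contra! hcon
    obtain ⟨ha, hb⟩ := hcon
    have h₁ := hc a b ha hb hab
    have h₂ := hc v a hvO ha (hadj v hvM w hwM a a.2 hvw)
    have h₃ := hc v b hvO hb (hadj v hvM w hwM b b.2 hvw)
    exact h₁ ((Bool.eq_not_of_ne h₂.symm).trans (Bool.eq_not_of_ne h₃.symm).symm)
  · refine isOCT_iff_exists_coloring.2 ⟨fun x => if x ∈ M then c w else c x,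
      fun x y hx hy hxy => ?_⟩
    by_cases hxM : x ∈ M <;> by_cases hyM : y ∈ M <;> simp [hxM, hyM] at hx hy ⊢
    · exact (hC (u := ⟨x, hxM⟩) (v := ⟨y, hyM⟩) hxy).elim hx hy
    · exact (hc y w hy hwO (hadj y hyM x hxM w hwM hxy.symm)).symm
    · exact hc x w hx hwO (hadj x hxM y hyM w hwM hxy)
    · exact hc x y hx hy hxy

theorem stmt7 {V : Type*} [Fintype V]
    (G : SimpleGraph V) (M : Set V)
    (hG : G.Connected) (hMod : G.IsModuleSet M) (hne : M.Nonempty)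
    (hproper : M ≠ Set.univ)
    (O : Set V) (hO : IsMinOCT G O) :
    M ∩ O = M ∨ IsMinVCover (G.induce M) {x : M | ↑x ∈ O} ∨
      IsMinOCT (G.induce M) {x : M | ↑x ∈ O} := by
  by_cases hMO : M ⊆ O
  · exact Or.inl (Set.inter_eq_left.2 hMO)
  obtain ⟨w, hwM, hwO⟩ := Set.not_subset.1 hMO
  by_cases hsep : ∀ v ∉ M, v ∉ O → ∀ m ∈ M, ¬ G.Adj v m
  · exact Or.inr (Or.inr (hO.restrict_of_separated hsep))
  · push Not at hsep
    obtain ⟨v, hvM, hvO, m, hm, hvm⟩ := hsep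
    have hvw : G.Adj v w :=
      (hMod v hvM).elim (fun h => h w hwM) fun h => absurd hvm (h m hm)
    exact Or.inr (Or.inl (hO.isMinVCover_restrict hMod hvM hvO hwM hwO hvw))
end

section
/- Let G be a connected graph, let M be a nonempty proper module of G, and let R be a minimum connected vertex cover of G. Then M ∩ R is either equal to M, a minimum vertex cover of the induced subgraph G[M], or a single vertex of M. -/
open SimpleGraph Set

/-- If `f` sends adjacent vertices to equal or adjacent ones, it preserves reachability. -/
theorem SimpleGraph.Reachable.map_of_eq_or_adj {V W : Type*} {G : SimpleGraph V}
    {H : SimpleGraph W} (f : V → W) (hf : ∀ x y, G.Adj x y → f x = f y ∨ H.Adj (f x) (f y))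
    {x y : V} (h : G.Reachable x y) : H.Reachable (f x) (f y) := by
  obtain ⟨p⟩ := h
  induction p with
  | nil => exact Reachable.refl _
  | cons hadj _ ih =>
    rcases hf _ _ hadj with heq | hadj'
    · rwa [heq]
    · exact hadj'.reachable.trans ih

/-- In a connected graph, a nonempty proper module has a vertex outside it adjacent to all
of it. -/
theorem SimpleGraph.IsModuleSet.exists_adj_all {V : Type*} {G : SimpleGraph V} {M : Set V}
    (hMod : G.IsModuleSet M) (hG : G.Connected) (hne : M.Nonempty) (hproper : M ≠ Set.univ) :
    ∃ n ∉ M, ∀ m ∈ M, G.Adj n m := by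
  obtain ⟨a, ha⟩ := hne
  obtain ⟨b, hb⟩ := (Set.ne_univ_iff_exists_notMem M).1 hproper
  obtain ⟨p⟩ := hG.preconnected a b
  obtain ⟨d, -, hd1, hd2⟩ := p.exists_boundary_dart M ha hb
  exact ⟨d.snd, hd2, (hMod d.snd hd2).resolve_right fun h => h _ hd1 d.adj.symm⟩

/-- Inside a module `M` not contained in a connected vertex cover `R`, the trace of `R` can be
replaced by any nonempty vertex cover of `G[M]`. -/
theorem IsCVCover.diff_union {V : Type*} {G : SimpleGraph V} {M R C : Set V}
    (hR : IsCVCover G R) (hMod : G.IsModuleSet M) (hG : G.Connected) (hproper : M ≠ Set.univ)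
    (hMR : ¬ M ⊆ R) (hCM : C ⊆ M) (hC : C.Nonempty)
    (hcov : ∀ u ∈ M, ∀ v ∈ M, G.Adj u v → u ∈ C ∨ v ∈ C) :
    IsCVCover G (R \ M ∪ C) := by
  classical
  obtain ⟨hRc, hRconn⟩ := hR
  obtain ⟨m, hmM, hmR⟩ := Set.not_subset.1 hMR
  obtain ⟨c, hc⟩ := hC
  have hfull : ∀ v ∉ M, ∀ w ∈ M, G.Adj v w → ∀ x ∈ M, G.Adj v x := fun v hv w hw h =>
    (hMod v hv).resolve_right fun h' => h' w hw h
  have hNR : ∀ v ∉ M, ∀ w ∈ M, G.Adj v w → v ∈ R := fun v hv w hw h =>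
    (hRc (hfull v hv w hw h m hmM)).resolve_right hmR
  obtain ⟨n, hnM, hn⟩ := hMod.exists_adj_all hG ⟨m, hmM⟩ hproper
  have hnR : n ∈ R := hNR n hnM m hmM (hn m hmM)
  constructor
  · intro u v huv
    by_cases hu : u ∈ M <;> by_cases hv : v ∈ M
    · exact (hcov u hu v hv huv).imp Or.inr Or.inr
    · exact Or.inr (Or.inl ⟨hNR v hv u hu huv.symm, hv⟩)
    · exact Or.inl (Or.inl ⟨hNR u hu v hv huv, hu⟩)
    · exact (hRc huv).imp (fun h => Or.inl ⟨h, hu⟩) (fun h => Or.inl ⟨h, hv⟩)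
  · let f : R → ↥(R \ M ∪ C) := fun x =>
      if h : (x : V) ∈ M then ⟨c, Or.inr hc⟩ else ⟨x, Or.inl ⟨x.2, h⟩⟩
    have hfout : ∀ (x : V) (hx : x ∈ R) (h : x ∉ M), f ⟨x, hx⟩ = ⟨x, Or.inl ⟨hx, h⟩⟩ :=
      fun x hx h => dif_neg h
    have hfin : ∀ (x : V) (hx : x ∈ R) (_ : x ∈ M), f ⟨x, hx⟩ = ⟨c, Or.inr hc⟩ :=
      fun x hx h => dif_pos h
    have hf : ∀ x y, (G.induce R).Adj x y →
        f x = f y ∨ (G.induce (R \ M ∪ C)).Adj (f x) (f y) := by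
      rintro ⟨x, hx⟩ ⟨y, hy⟩ hxy
      rw [comap_adj] at hxy
      by_cases hxM : x ∈ M <;> by_cases hyM : y ∈ M
      · exact Or.inl (by rw [hfin x hx hxM, hfin y hy hyM])
      · rw [hfin x hx hxM, hfout y hy hyM]
        exact Or.inr (hfull y hyM x hxM hxy.symm c (hCM hc)).symm
      · rw [hfout x hx hxM, hfin y hy hyM]
        exact Or.inr (hfull x hxM y hyM hxy c (hCM hc))
      · rw [hfout x hx hxM, hfout y hy hyM]
        exact Or.inr hxy
    refine (connected_iff_exists_forall_reachable _).2 ⟨⟨n, Or.inl ⟨hnR, hnM⟩⟩, ?_⟩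
    rintro ⟨x, hx | hx⟩
    · have h := (hRconn.preconnected ⟨n, hnR⟩ ⟨x, hx.1⟩).map_of_eq_or_adj f hf
      rwa [hfout n hnR hnM, hfout x hx.1 hx.2] at h
    · exact Adj.reachable (G := G.induce (R \ M ∪ C)) (hn x (hCM hx))

theorem stmt8 {V : Type*} [Fintype V]
    (G : SimpleGraph V) (M : Set V)
    (hG : G.Connected) (hMod : G.IsModuleSet M) (hne : M.Nonempty)
    (hproper : M ≠ Set.univ)
    (R : Set V) (hR : IsMinCVCover G R) :
    M ∩ R = M ∨ IsMinVCover (G.induce M) {x : M | ↑x ∈ R} ∨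
      (∃ v ∈ M, M ∩ R = {v}) := by
  by_cases hMR : M ⊆ R
  · exact Or.inl (Set.inter_eq_left.2 hMR)
  right
  have hle : ∀ C ⊆ M, C.Nonempty → (∀ u ∈ M, ∀ v ∈ M, G.Adj u v → u ∈ C ∨ v ∈ C) →
      (M ∩ R).ncard ≤ C.ncard := by
    intro C hCM hC hcov
    have h1 := hR.2 _ (hR.1.diff_union hMod hG hproper hMR hCM hC hcov)
    have h2 := Set.ncard_union_le (R \ M) C
    have h3 := Set.ncard_inter_add_ncard_sdiff_eq_ncard R M (Set.toFinite R)
    rw [Set.inter_comm] at h3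
    omega
  have htrace : (Subtype.val '' {x : M | ↑x ∈ R}) = M ∩ R := Subtype.image_preimage_coe M R
  have hcard : {x : M | ↑x ∈ R}.ncard = (M ∩ R).ncard := by
    rw [← htrace, Set.ncard_image_of_injective _ Subtype.val_injective]
  refine or_iff_not_imp_left.2 fun hmin => ?_
  have hlt : ∃ C : Set M, IsVCover (G.induce M) C ∧ C.ncard < (M ∩ R).ncard := by
    by_contra! h
    exact hmin ⟨fun u v huv => hR.1.1 huv, fun C hC => hcard ▸ h C hC⟩
  obtain ⟨C, hC, hClt⟩ := hlt
  rcases C.eq_empty_or_nonempty with rfl | hCne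
  · obtain ⟨v, hv⟩ := (Set.ncard_pos (Set.toFinite (M ∩ R))).1 (Nat.zero_lt_of_lt hClt)
    have h1 := hle {v} (Set.singleton_subset_iff.2 hv.1) (Set.singleton_nonempty v)
      fun a ha b hb hab => ((hC (u := ⟨a, ha⟩) (v := ⟨b, hb⟩) hab).elim id id).elim
    exact ⟨v, hv.1, (Set.eq_of_subset_of_ncard_le (Set.singleton_subset_iff.2 hv) h1).symm⟩
  · have h1 := hle (Subtype.val '' C) (Subtype.coe_image_subset M C) (hCne.image _)
      fun a ha b hb hab => (hC (u := ⟨a, ha⟩) (v := ⟨b, hb⟩) hab).imp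
        (fun h => ⟨_, h, rfl⟩) (fun h => ⟨_, h, rfl⟩)
    rw [Set.ncard_image_of_injective _ Subtype.val_injective] at h1
    omega
end

section
/- Let G and H be connected graphs, let M be a nonempty proper module of G, and let G' be the graph obtained from G by replacing G[M] with H. If |M| = |V(H)| and the minimum vertex covers of G[M] and of H have the same size, then the size of a minimum vertex cover of G' is at most the size of a minimum vertex cover of G. -/
open SimpleGraph Set

theorem vcNum_le {V : Type*} (G : SimpleGraph V) {C : Set V} (hC : IsVCover G C) :
    vcNum G ≤ C.ncard :=
  Nat.sInf_le ⟨C, hC, rfl⟩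

theorem exists_isVCover_ncard_eq_vcNum {V : Type*} (G : SimpleGraph V) :
    ∃ C, IsVCover G C ∧ C.ncard = vcNum G :=
  Nat.sInf_mem (s := {n | ∃ C, IsVCover G C ∧ C.ncard = n})
    ⟨_, Set.univ, fun _ _ _ => Or.inl (Set.mem_univ _), rfl⟩

/-- A cover of `G`, restricted to `V ∖ M`, and a cover of `H` combine to a cover of the replacement,
provided all edges between the two sides are covered. -/
theorem isVCover_modularReplacement {V W : Type*} {G : SimpleGraph V} {H : SimpleGraph W}
    {M C : Set V} {T : Set W} (hC : IsVCover G C) (hT : IsVCover H T)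
    (hcross : T = Set.univ ∨ ∀ u ∉ M, (∃ m ∈ M, G.Adj u m) → u ∈ C) :
    IsVCover (modularReplacement G M H)
      (Sum.inl '' (Subtype.val ⁻¹' C) ∪ Sum.inr '' T) := by
  have hmixed : ∀ (u : {v : V // v ∉ M}) (w : W), (∃ m ∈ M, G.Adj u.1 m) → u.1 ∈ C ∨ w ∈ T := by
    intro u w h
    rcases hcross with rfl | hcross
    · exact Or.inr (Set.mem_univ w)
    · exact Or.inl (hcross u.1 u.2 h)
  rintro (u | u) (v | v) ⟨-, h⟩ <;> simp only [or_false, false_or] at h <;>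
    simp only [Set.mem_union, Set.mem_image, Set.mem_preimage, Sum.inl.injEq, Sum.inr.injEq,
      exists_eq_right, reduceCtorEq, and_false, exists_false, or_false, false_or]
  · exact h.elim (fun h => hC h) (fun h => hC h.symm)
  · exact hmixed u v h
  · exact (hmixed v u h).symm
  · exact h.elim (fun h => hT h) (fun h => hT h.symm)

theorem stmt10 {V W : Type*} [Fintype V] [Fintype W]
    (G : SimpleGraph V) (H : SimpleGraph W) (M : Set V)
    (hG : G.Connected) (hH : H.Connected)
    (hMod : G.IsModuleSet M) (hne : M.Nonempty) (hproper : M ≠ Set.univ)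
    (hcard : M.ncard = Fintype.card W)
    (hvc : vcNum (G.induce M) = vcNum H) :
    vcNum (modularReplacement G M H) ≤ vcNum G := by
  obtain ⟨C, hC, hCcard⟩ := exists_isVCover_ncard_eq_vcNum G
  obtain ⟨T, hT, hTcard, hcross⟩ : ∃ T : Set W, IsVCover H T ∧ T.ncard ≤ (C ∩ M).ncard ∧
      (T = Set.univ ∨ ∀ u ∉ M, (∃ m ∈ M, G.Adj u m) → u ∈ C) := by
    by_cases hMC : M ⊆ C
    · refine ⟨Set.univ, fun _ _ _ => Or.inl (Set.mem_univ _), ?_, Or.inl rfl⟩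
      rw [Set.inter_eq_right.mpr hMC, hcard, Set.ncard_univ, Nat.card_eq_fintype_card]
    · obtain ⟨m, hmM, hmC⟩ := Set.not_subset.mp hMC
      obtain ⟨T, hT, hTcard⟩ := exists_isVCover_ncard_eq_vcNum H
      refine ⟨T, hT, ?_, Or.inr ?_⟩
      · have hcover : IsVCover (G.induce M) (Subtype.val ⁻¹' C) := fun _ _ h => hC h
        have hle := vcNum_le _ hcover
        rw [← Set.ncard_image_of_injective _ Subtype.val_injective,
          Subtype.image_preimage_coe, Set.inter_comm] at hle
        omega
      · rintro u hu ⟨m', hm', hadj⟩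
        rcases hMod u hu with hall | hnone
        · exact (hC (hall m hmM)).resolve_right hmC
        · exact absurd hadj (hnone m' hm')
  refine (vcNum_le _ (isVCover_modularReplacement hC hT hcross)).trans ?_
  have hout : (Subtype.val ⁻¹' C : Set {v : V // v ∉ M}).ncard = (C \ M).ncard := by
    rw [← Set.ncard_image_of_injective _ Subtype.val_injective]
    congr 1
    ext x
    simp
  have hsplit := Set.ncard_inter_add_ncard_sdiff_eq_ncard C M
  have hunion := Set.ncard_union_le (Sum.inl '' (Subtype.val ⁻¹' C : Set {v : V // v ∉ M}))
    (Sum.inr '' T)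
  rw [Set.ncard_image_of_injective _ Sum.inl_injective,
    Set.ncard_image_of_injective _ Sum.inr_injective] at hunion
  omega
end
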